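/- Let m ≥ 1 be an integer, let (R, 𝒜) be a commutative ℤ/m-graded ring, and let b ∈ R be a unit of R with b ∈ 𝒜 1. Then b^m ∈ 𝒜 0, and the 𝒜 0-algebra homomorphism from 𝒜 0[X]/(X^m − b^m) to R sending X to b is bijective; that is, R is isomorphic, as an algebra over its weight-0 subring, to 𝒜 0[X]/(X^m − b^m) with X of weight 1. -/

import Mathlib

open Polynomial

/-- The inverse of a homogeneous unit of degree `i` is homogeneous of degree `-i`. -/
theorem GradedRing.units_inv_mem {ι R : Type*} [AddCommGroup ι] [DecidableEq ι] [CommRing R]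
    (𝒜 : ι → AddSubgroup R) [GradedRing 𝒜] {i : ι} {b : Rˣ} (hb : (b : R) ∈ 𝒜 i) :
    ((b⁻¹ : Rˣ) : R) ∈ 𝒜 (-i) := by
  have h := DirectSum.coe_decompose_mul_add_of_left_mem 𝒜 (j := -i)
    (b := ((b⁻¹ : Rˣ) : R)) hb
  rw [Units.mul_inv, add_neg_cancel,
    DirectSum.decompose_of_mem_same 𝒜 SetLike.GradedOne.one_mem] at h
  rw [Units.inv_eq_of_mul_eq_one_right h.symm]
  exact SetLike.coe_mem _

/-- A polynomial of degree less than `m` over the weight-zero subring of a `ℤ/m`-graded ring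
vanishes if it is zero at a weight-one unit. -/
theorem GradedRing.eq_zero_of_eval₂_eq_zero_of_degree_lt {m : ℕ} {R : Type*} [CommRing R]
    (𝒜 : ZMod m → AddSubgroup R) [GradedRing 𝒜] {b : Rˣ} (hb : (b : R) ∈ 𝒜 1)
    {p : (SetLike.GradeZero.subring 𝒜)[X]} (hp : p.degree < m)
    (h : p.eval₂ (SetLike.GradeZero.subring 𝒜).subtype (b : R) = 0) : p = 0 := by
  have hmem (k : ℕ) : (p.coeff k : R) * (b : R) ^ k ∈ 𝒜 (k : ZMod m) := by
    simpa using SetLike.mul_mem_graded (p.coeff k).2 (SetLike.pow_mem_graded k hb)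
  ext k
  rcases le_or_gt m k with hk | hk
  · rw [coeff_eq_zero_of_degree_lt (hp.trans_le (by exact_mod_cast hk))]
    simp
  have hsum : ∑ j ∈ Finset.range m, (p.coeff j : R) * (b : R) ^ j = 0 := by
    rw [← h, eval₂_eq_sum, sum_over_range' _ _ m]
    · rfl
    · by_cases h0 : p = 0
      · simpa [h0] using (Nat.zero_le k).trans_lt hk
      · exact (natDegree_lt_iff_degree_lt h0).2 hp
    · simp
  have hcomp := congrArg (fun r => (DirectSum.decompose 𝒜 r (k : ZMod m) : R)) hsum
  simp only [DirectSum.decompose_sum, DirectSum.sum_apply, AddSubgroup.val_finsetSum,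
    DirectSum.decompose_zero, DirectSum.zero_apply, ZeroMemClass.coe_zero] at hcomp
  rw [Finset.sum_eq_single_of_mem k (Finset.mem_range.2 hk),
    DirectSum.decompose_of_mem_same 𝒜 (hmem k)] at hcomp
  · simpa [← Units.val_pow_eq_pow_val] using hcomp
  · intro j hj hjk
    refine DirectSum.decompose_of_mem_ne 𝒜 (hmem j) fun hjk' => hjk ?_
    rw [ZMod.natCast_eq_natCast_iff] at hjk'
    exact hjk'.eq_of_lt_of_lt (Finset.mem_range.1 hj) hk

/-- Let `(R, 𝒜)` be a commutative `ℤ/m`-graded ring (`m ≥ 1`) and `b` a unit of `R` with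
`b ∈ 𝒜 1`.  Then `b^m ∈ 𝒜 0`, and the `𝒜 0`-algebra homomorphism
`𝒜 0[X]/(X^m - b^m) → R` sending `X` to `b` is bijective. -/
theorem graded_ring_with_weight_one_unit_is_adjoin_root (m : ℕ) (hm : 1 ≤ m)
    (R : Type*) [CommRing R] (𝒜 : ZMod m → AddSubgroup R) [GradedRing 𝒜]
    (b : Rˣ) (hb : (b : R) ∈ 𝒜 1) :
    ∃ (h0 : (b : R) ^ m ∈ 𝒜 0)
      (heval : Polynomial.eval₂ (SetLike.GradeZero.subring 𝒜).subtype (b : R)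
        (X ^ m - C (⟨(b : R) ^ m, h0⟩ : SetLike.GradeZero.subring 𝒜)) = 0),
      Function.Bijective
        (AdjoinRoot.lift (SetLike.GradeZero.subring 𝒜).subtype (b : R) heval) := by
  have : NeZero m := ⟨by omega⟩
  have h0 : (b : R) ^ m ∈ 𝒜 0 := by simpa using SetLike.pow_mem_graded m hb
  have heval : Polynomial.eval₂ (SetLike.GradeZero.subring 𝒜).subtype (b : R)
      (X ^ m - C (⟨(b : R) ^ m, h0⟩ : SetLike.GradeZero.subring 𝒜)) = 0 := by
    simp [eval₂_sub]
  refine ⟨h0, heval, ?_, fun r => ?_⟩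
  · rw [injective_iff_map_eq_zero]
    intro x hx
    rcases subsingleton_or_nontrivial (SetLike.GradeZero.subring 𝒜) with _ | _
    · have := Module.subsingleton (SetLike.GradeZero.subring 𝒜)
        (AdjoinRoot (X ^ m - C (⟨(b : R) ^ m, h0⟩ : SetLike.GradeZero.subring 𝒜)))
      exact Subsingleton.elim _ _
    obtain ⟨p, rfl⟩ := AdjoinRoot.mk_surjective x
    have hmonic := monic_X_pow_sub_C
      (⟨(b : R) ^ m, h0⟩ : SetLike.GradeZero.subring 𝒜) (NeZero.ne m)
    rw [AdjoinRoot.lift_mk, ← eval₂_modByMonic_eq_self_of_root heval] at hx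
    rw [AdjoinRoot.mk_eq_zero, ← modByMonic_eq_zero_iff_dvd hmonic]
    refine GradedRing.eq_zero_of_eval₂_eq_zero_of_degree_lt 𝒜 hb ?_ hx
    simpa only [degree_X_pow_sub_C hm] using degree_modByMonic_lt p hmonic
  · classical
    rw [← RingHom.mem_range, ← DirectSum.sum_support_decompose 𝒜 r]
    refine sum_mem fun i _ => ?_
    have hmem : (DirectSum.decompose 𝒜 r i : R) * ((b⁻¹ : Rˣ) : R) ^ i.val ∈ 𝒜 0 := by
      simpa using SetLike.mul_mem_graded (SetLike.coe_mem (DirectSum.decompose 𝒜 r i))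
        (SetLike.pow_mem_graded i.val (GradedRing.units_inv_mem 𝒜 hb))
    refine ⟨AdjoinRoot.mk _ (C (⟨_, hmem⟩ : SetLike.GradeZero.subring 𝒜) * X ^ i.val), ?_⟩
    simp [mul_assoc, ← mul_pow]
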